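/- arXiv:1406.7364 — 7 statements merged into one kernel-verified Lean document; each statement's English description precedes it below -/
import Mathlib

section
/- Let X₁ and X₂ be topological spaces, let A¹ = (a¹_N)_{N∈ℕ} be an increasing sequence of weights on X₁ and A² = (a²_n)_{n∈ℕ} an increasing sequence of weights on X₂. If A¹ satisfies condition (Ω)_w and A² satisfies condition (DN)_w, then the double sequence 𝒜 = (a_{N,n})_{N,n∈ℕ} on X₁ × X₂ defined by a_{N,n}(x₁,x₂) := a¹_N(x₁)/a²_n(x₂) satisfies condition (wQ). -/
open Set Filter

/-- If an increasing sequence of weights `a₁` on `X₁` satisfies `(Ω)_w`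
and an increasing sequence of weights `a₂` on `X₂` satisfies `(DN)_w`, then the double
sequence `a_{N,n}(x₁,x₂) = a₁ N x₁ / a₂ n x₂` on `X₁ × X₂` satisfies `(wQ)`. -/
theorem stmt_0 {X₁ X₂ : Type*} [TopologicalSpace X₁] [TopologicalSpace X₂]
    (a₁ : ℕ → X₁ → ℝ) (a₂ : ℕ → X₂ → ℝ)
    (ha₁cont : ∀ N, Continuous (a₁ N)) (ha₁pos : ∀ N x, 0 < a₁ N x)
    (ha₁mono : ∀ N x, a₁ N x ≤ a₁ (N + 1) x)
    (ha₂cont : ∀ n, Continuous (a₂ n)) (ha₂pos : ∀ n x, 0 < a₂ n x)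
    (ha₂mono : ∀ n x, a₂ n x ≤ a₂ (n + 1) x)
    (hΩ : ∀ N, ∃ M, N ≤ M ∧ ∀ K, M ≤ K → ∃ D > (0 : ℝ), ∃ θ ∈ Set.Ioo (0 : ℝ) 1,
      ∀ x, 1 / a₁ M x ≤ D * (1 / a₁ K x) ^ θ * (1 / a₁ N x) ^ (1 - θ))
    (hDN : ∃ n, ∀ m, n ≤ m → ∀ θ ∈ Set.Ioo (0 : ℝ) 1, ∃ k, m ≤ k ∧ ∃ C > (0 : ℝ),
      ∀ x, a₂ m x ≤ C * a₂ k x ^ θ * a₂ n x ^ (1 - θ)) :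
    ∀ N, ∃ M, N ≤ M ∧ ∃ n, ∀ K, M ≤ K → ∀ m, ∃ k, ∃ S > (0 : ℝ),
      ∀ (x₁ : X₁) (x₂ : X₂),
        1 / (a₁ M x₁ / a₂ m x₂) ≤
          max (S / (a₁ N x₁ / a₂ n x₂)) (S / (a₁ K x₁ / a₂ k x₂)) := by
  intro N
  obtain ⟨M, hNM, hM⟩ := hΩ N
  obtain ⟨n, hn⟩ := hDN
  refine ⟨M, hNM, n, ?_⟩
  intro K hK m
  obtain ⟨D, hD, θ, hθ, hΩ'⟩ := hM K hK
  obtain ⟨k, hk, C, hC, hDN'⟩ := hn (max m n) (le_max_right _ _) θ hθ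
  refine ⟨k, D * C, mul_pos hD hC, ?_⟩
  intro x₁ x₂
  have hmono : a₂ m x₂ ≤ a₂ (max m n) x₂ :=
    (monotone_nat_of_le_succ (f := fun j => a₂ j x₂) (fun j => ha₂mono j x₂)) (le_max_left m n)
  have h1 := hΩ' x₁
  have h2 := hmono.trans (hDN' x₂)
  have hu : 0 < 1 / a₁ K x₁ := one_div_pos.mpr (ha₁pos K x₁)
  have hv : 0 < 1 / a₁ N x₁ := one_div_pos.mpr (ha₁pos N x₁)
  have hw : 0 < 1 / a₁ M x₁ := one_div_pos.mpr (ha₁pos M x₁)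
  have hr := ha₂pos k x₂
  have hs := ha₂pos n x₂
  have ht := ha₂pos m x₂
  have e1 : 1 / (a₁ M x₁ / a₂ m x₂) = (1 / a₁ M x₁) * a₂ m x₂ := by
    rw [one_div_div]; ring
  have e2 : D * C / (a₁ N x₁ / a₂ n x₂) = D * C * (1 / a₁ N x₁ * a₂ n x₂) := by
    rw [div_div_eq_mul_div]; ring
  have e3 : D * C / (a₁ K x₁ / a₂ k x₂) = D * C * (1 / a₁ K x₁ * a₂ k x₂) := by
    rw [div_div_eq_mul_div]; ring
  rw [e1, e2, e3, ← mul_max_of_nonneg _ _ (mul_pos hD hC).le]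
  generalize 1 / a₁ K x₁ = u at *
  generalize 1 / a₁ N x₁ = v at *
  generalize 1 / a₁ M x₁ = w at *
  generalize a₂ k x₂ = r at *
  generalize a₂ n x₂ = s at *
  generalize a₂ m x₂ = t at *
  have hp : 0 < u * r := mul_pos hu hr
  have hq : 0 < v * s := mul_pos hv hs
  have hmax : 0 < max (v * s) (u * r) := lt_max_of_lt_left hq
  have hθ1 : 0 ≤ 1 - θ := by linarith [hθ.2]
  calc w * t ≤ (D * u ^ θ * v ^ (1 - θ)) * (C * r ^ θ * s ^ (1 - θ)) :=
        mul_le_mul h1 h2 ht.le (by positivity)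
    _ = D * C * ((u * r) ^ θ * (v * s) ^ (1 - θ)) := by
        rw [Real.mul_rpow hu.le hr.le, Real.mul_rpow hv.le hs.le]; ring
    _ ≤ D * C * (max (v * s) (u * r) ^ θ * max (v * s) (u * r) ^ (1 - θ)) := by
        have i1 := Real.rpow_le_rpow hp.le (le_max_right (v * s) (u * r)) hθ.1.le
        have i2 := Real.rpow_le_rpow hq.le (le_max_left (v * s) (u * r)) hθ1
        gcongr
    _ = D * C * max (v * s) (u * r) := by
        rw [← Real.rpow_add hmax]; simp
end

section
/- Let X be a nonempty Hausdorff, locally compact and σ-compact topological space and let A = (a_n)_{n∈ℕ} be an increasing sequence of weights on X. Let E be the set of continuous functions f : X → ℂ such that a_n·|f| vanishes at infinity on X for every n, and put ‖f‖_n := sup_{x∈X} a_n(x)·|f(x)| for f ∈ E. Then the following are equivalent: (i) ∃ n, ∀ m ≥ n, ∀ θ ∈ (0,1), ∃ k ≥ m, ∃ C > 0, ∀ f ∈ E: ‖f‖_m ≤ C·‖f‖_k^θ·‖f‖_n^{1−θ} (i.e., E satisfies condition (DN) with respect to the canonical seminorms); (ii) A satisfies condition (DN)_w, i.e., ∃ n,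 ∀ m ≥ n, ∀ θ ∈ (0,1), ∃ k ≥ m, ∃ C > 0, ∀ x ∈ X: a_m(x) ≤ C·a_k(x)^θ·a_n(x)^{1−θ}. -/
open Set Filter Topology

lemma bdd_of_tendsto_cocompact {X : Type*} [TopologicalSpace X] (g : X → ℝ)
    (hg : Continuous g) (h : Tendsto g (cocompact X) (𝓝 0)) : BddAbove (Set.range g) := by
  have h1 : ∀ᶠ x in cocompact X, g x < 1 := h.eventually (gt_mem_nhds one_pos)
  obtain ⟨K, hK, hKs⟩ := Filter.mem_cocompact.1 h1
  obtain ⟨M, hM⟩ := hK.bddAbove_image hg.continuousOn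
  refine ⟨max M 1, ?_⟩
  rintro _ ⟨x, rfl⟩
  by_cases hx : x ∈ K
  · exact le_max_of_le_left (hM ⟨x, hx, rfl⟩)
  · exact le_max_of_le_right (le_of_lt (hKs hx))

/-- For an increasing sequence of weights `a` on a nonempty Hausdorff
locally compact σ-compact space `X`, the weighted Fréchet space
`E = {f : X → ℂ | f continuous, aₙ·|f| vanishes at infinity for all n}` with seminorms
`‖f‖ₙ = sup_x aₙ x * ‖f x‖` satisfies condition (DN) if and only if the sequence `a`
satisfies the weight condition `(DN)_w`. -/
theorem stmt_1 {X : Type*} [TopologicalSpace X] [Nonempty X] [T2Space X]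
    [LocallyCompactSpace X] [SigmaCompactSpace X]
    (a : ℕ → X → ℝ)
    (hacont : ∀ n, Continuous (a n)) (hapos : ∀ n x, 0 < a n x)
    (hamono : ∀ n x, a n x ≤ a (n + 1) x)
    (E : Set (X → ℂ))
    (hE : E = {f | Continuous f ∧
      ∀ n, Tendsto (fun x => a n x * ‖f x‖) (cocompact X) (𝓝 0)}) :
    (∃ n, ∀ m, n ≤ m → ∀ θ ∈ Set.Ioo (0 : ℝ) 1, ∃ k, m ≤ k ∧ ∃ C > (0 : ℝ),
      ∀ f ∈ E, (⨆ x, a m x * ‖f x‖) ≤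
        C * (⨆ x, a k x * ‖f x‖) ^ θ * (⨆ x, a n x * ‖f x‖) ^ (1 - θ)) ↔
    (∃ n, ∀ m, n ≤ m → ∀ θ ∈ Set.Ioo (0 : ℝ) 1, ∃ k, m ≤ k ∧ ∃ C > (0 : ℝ),
      ∀ x, a m x ≤ C * a k x ^ θ * a n x ^ (1 - θ)) := by
  subst hE
  constructor
  · rintro ⟨n, hn⟩
    refine ⟨n, fun m hm θ hθ => ?_⟩
    obtain ⟨k, hk, C, hC, h⟩ := hn m hm θ hθ
    refine ⟨k, hk, 2 * C, by positivity, fun x => ?_⟩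
    have hU : IsOpen {y | a k y < 2 * a k x ∧ a n y < 2 * a n x} :=
      (isOpen_lt (hacont k) continuous_const).inter (isOpen_lt (hacont n) continuous_const)
    obtain ⟨g, hg1, hg0, hgc, hg01⟩ := exists_continuous_one_zero_of_isCompact
      (isCompact_singleton (x := x)) hU.isClosed_compl
      (by
        rw [Set.disjoint_singleton_left]
        intro hx
        exact hx ⟨by linarith [hapos k x], by linarith [hapos n x]⟩)
    have hgx : g x = 1 := hg1 rfl
    have hnorm : ∀ y, ‖((g y : ℝ) : ℂ)‖ = g y := fun y => by
      rw [Complex.norm_real, Real.norm_of_nonneg (hg01 y).1]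
    have htend : ∀ j, Tendsto (fun y => a j y * ‖((g y : ℝ) : ℂ)‖) (cocompact X) (𝓝 0) := by
      intro j
      simp only [hnorm]
      have hc : HasCompactSupport (fun y => a j y * g y) := hgc.mul_left
      exact hc.is_zero_at_infty
    have hcont : Continuous (fun y => ((g y : ℝ) : ℂ)) :=
      Complex.continuous_ofReal.comp g.continuous
    have key := h (fun y => ((g y : ℝ) : ℂ)) ⟨hcont, htend⟩
    have hlow : a m x ≤ ⨆ y, a m y * ‖((g y : ℝ) : ℂ)‖ := by
      have h0 : a m x * ‖((g x : ℝ) : ℂ)‖ ≤ ⨆ y, a m y * ‖((g y : ℝ) : ℂ)‖ :=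
        le_ciSup (bdd_of_tendsto_cocompact _ ((hacont m).mul hcont.norm) (htend m)) x
      rwa [hnorm x, hgx, mul_one] at h0
    have hup : ∀ j, (∀ y, g y ≠ 0 → a j y < 2 * a j x) →
        (⨆ y, a j y * ‖((g y : ℝ) : ℂ)‖) ≤ 2 * a j x := by
      intro j hj
      refine ciSup_le fun y => ?_
      rw [hnorm]
      by_cases hy : g y = 0
      · rw [hy, mul_zero]; linarith [hapos j x]
      · have h1 := hj y hy
        have h2 := (hg01 y).2
        nlinarith [hapos j y]
    have hmem : ∀ y, g y ≠ 0 → a k y < 2 * a k x ∧ a n y < 2 * a n x := by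
      intro y hy
      by_contra hcon
      exact hy (hg0 hcon)
    have hnn : ∀ j, 0 ≤ ⨆ y, a j y * ‖((g y : ℝ) : ℂ)‖ := fun j =>
      Real.iSup_nonneg fun y => mul_nonneg (hapos j y).le (norm_nonneg _)
    have h1θ : 0 ≤ 1 - θ := by linarith [hθ.2]
    have hk' := Real.rpow_le_rpow (hnn k) (hup k fun y hy => (hmem y hy).1) hθ.1.le
    have hn' := Real.rpow_le_rpow (hnn n) (hup n fun y hy => (hmem y hy).2) h1θ
    have h2 : (2 : ℝ) ^ θ * 2 ^ (1 - θ) = 2 := by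
      rw [← Real.rpow_add two_pos]; simp
    calc a m x ≤ _ := hlow
      _ ≤ _ := key
      _ ≤ C * (2 * a k x) ^ θ * (2 * a n x) ^ (1 - θ) :=
        mul_le_mul (mul_le_mul_of_nonneg_left hk' hC.le) hn' (Real.rpow_nonneg (hnn n) _)
          (mul_nonneg hC.le (Real.rpow_nonneg (by linarith [hapos k x]) _))
      _ = (2 ^ θ * 2 ^ (1 - θ)) * C * a k x ^ θ * a n x ^ (1 - θ) := by
        rw [Real.mul_rpow two_pos.le (hapos k x).le, Real.mul_rpow two_pos.le (hapos n x).le]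
        ring
      _ = _ := by rw [h2]
  · rintro ⟨n, hn⟩
    refine ⟨n, fun m hm θ hθ => ?_⟩
    obtain ⟨k, hk, C, hC, h⟩ := hn m hm θ hθ
    refine ⟨k, hk, C, hC, ?_⟩
    rintro f ⟨hf, hft⟩
    refine ciSup_le fun x => ?_
    have h1θ : 0 ≤ 1 - θ := by linarith [hθ.2]
    have hle : ∀ j, a j x * ‖f x‖ ≤ ⨆ y, a j y * ‖f y‖ := fun j =>
      le_ciSup (bdd_of_tendsto_cocompact _ ((hacont j).mul hf.norm) (hft j)) x
    have hnn : ∀ j, 0 ≤ a j x * ‖f x‖ := fun j => mul_nonneg (hapos j x).le (norm_nonneg _)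
    have hk' := Real.rpow_le_rpow (hnn k) (hle k) hθ.1.le
    have hn' := Real.rpow_le_rpow (hnn n) (hle n) h1θ
    have h2 : ‖f x‖ ^ θ * ‖f x‖ ^ (1 - θ) = ‖f x‖ := by
      rw [← Real.rpow_add_of_nonneg (norm_nonneg _) hθ.1.le h1θ]; simp
    calc a m x * ‖f x‖ ≤ (C * a k x ^ θ * a n x ^ (1 - θ)) * ‖f x‖ :=
        mul_le_mul_of_nonneg_right (h x) (norm_nonneg _)
      _ = (C * a k x ^ θ * a n x ^ (1 - θ)) * (‖f x‖ ^ θ * ‖f x‖ ^ (1 - θ)) := by rw [h2]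
      _ = C * (a k x * ‖f x‖) ^ θ * (a n x * ‖f x‖) ^ (1 - θ) := by
        rw [Real.mul_rpow (hapos k x).le (norm_nonneg _),
          Real.mul_rpow (hapos n x).le (norm_nonneg _)]
        ring
      _ ≤ _ :=
        mul_le_mul (mul_le_mul_of_nonneg_left hk' hC.le) hn' (Real.rpow_nonneg (hnn n) _)
          (mul_nonneg hC.le (Real.rpow_nonneg ((hnn k).trans (hle k)) _))
end

section
/- Let X be a nonempty Hausdorff, locally compact and σ-compact topological space and let A = (a_n)_{n∈ℕ} be an increasing sequence of weights on X. Let E be the set of continuous functions f : X → ℂ such that a_n·|f| vanishes at infinity on X for every n, with ‖f‖_n := sup_{x∈X} a_n(x)·|f(x)|, and for a linear functional y : E → ℂ set ‖y‖*_n := sup{ |y(f)| : f ∈ E, ‖f‖_n ≤ 1 } ∈ [0,∞] (extended real valued). Then the following are equivalent: (i) ∀ N, ∃ M ≥ N, ∀ K ≥ M, ∃ D > 0, ∃ θ ∈ (0,1), such that every linear functional y : E → ℂ satisfies ‖y‖*_M ≤ D·(‖y‖*_K)^θ·(‖y‖*_N)^{1−θ} in [0,∞] (i.e., E satisfies condition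 (Ω) with respect to the canonical seminorms); (ii) A satisfies condition (Ω)_w, i.e., ∀ N, ∃ M ≥ N, ∀ K ≥ M, ∃ D > 0, ∃ θ ∈ (0,1), ∀ x ∈ X: 1/a_M(x) ≤ D·(1/a_K(x))^θ·(1/a_N(x))^{1−θ}. -/
open Set Filter Topology ENNReal

/-- The space of continuous functions `f : X → ℂ` such that `aₙ·|f|` vanishes at
infinity on `X` for every `n`, as a `ℂ`-submodule of `X → ℂ`. -/
noncomputable def weightedSpace {X : Type*} [TopologicalSpace X]
    (a : ℕ → X → ℝ) (hapos : ∀ n x, 0 < a n x) : Submodule ℂ (X → ℂ) where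
  carrier := {f | Continuous f ∧
    ∀ n, Tendsto (fun x => a n x * ‖f x‖) (cocompact X) (𝓝 0)}
  zero_mem' := by
    refine ⟨continuous_const, fun n => ?_⟩
    simpa using (tendsto_const_nhds :
      Tendsto (fun _ : X => (0 : ℝ)) (cocompact X) (𝓝 0))
  add_mem' := by
    rintro f g ⟨hfc, hft⟩ ⟨hgc, hgt⟩
    refine ⟨hfc.add hgc, fun n => ?_⟩
    have h := (hft n).add (hgt n)
    rw [add_zero] at h
    refine squeeze_zero (fun x => mul_nonneg (hapos n x).le (norm_nonneg _))
      (fun x => ?_) h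
    calc a n x * ‖(f + g) x‖ ≤ a n x * (‖f x‖ + ‖g x‖) := by
          refine mul_le_mul_of_nonneg_left ?_ (hapos n x).le
          simpa using norm_add_le (f x) (g x)
      _ = a n x * ‖f x‖ + a n x * ‖g x‖ := by ring
  smul_mem' := by
    rintro c f ⟨hfc, hft⟩
    refine ⟨hfc.const_smul c, fun n => ?_⟩
    have h := (hft n).const_mul ‖c‖
    rw [mul_zero] at h
    refine h.congr fun x => ?_
    simp only [Pi.smul_apply, norm_smul]
    ring

section helpers

variable {X : Type*} [TopologicalSpace X] {a : ℕ → X → ℝ} {hapos : ∀ n x, 0 < a n x}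

theorem ws_bdd (hacont : ∀ n, Continuous (a n)) (n : ℕ) (f : weightedSpace a hapos) :
    BddAbove (Set.range fun x => a n x * ‖(f : X → ℂ) x‖) := by
  let g : ZeroAtInftyContinuousMap X ℝ :=
    ⟨⟨fun x => a n x * ‖(f : X → ℂ) x‖, (hacont n).mul f.2.1.norm⟩, f.2.2 n⟩
  exact (ZeroAtInftyContinuousMap.isBounded_range g).bddAbove

theorem ws_le (hacont : ∀ n, Continuous (a n)) (n : ℕ) (f : weightedSpace a hapos)
    {C : ℝ} (h : (⨆ x, a n x * ‖(f : X → ℂ) x‖) ≤ C) (x : X) :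
    a n x * ‖(f : X → ℂ) x‖ ≤ C :=
  (le_ciSup (ws_bdd hacont n f) x).trans h

theorem ws_dual_bound [Nonempty X] (n : ℕ) (y : (weightedSpace a hapos) →ₗ[ℂ] ℂ)
    (f : weightedSpace a hapos) {C : ℝ} (hC : 0 < C)
    (h : ∀ x, a n x * ‖(f : X → ℂ) x‖ ≤ C) :
    (‖y f‖₊ : ℝ≥0∞) ≤ ENNReal.ofReal C *
      ⨆ (f : weightedSpace a hapos) (_ : (⨆ x, a n x * ‖(f : X → ℂ) x‖) ≤ 1),
        (‖y f‖₊ : ℝ≥0∞) := by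
  have h1 : (⨆ x, a n x * ‖(((C⁻¹ : ℝ) : ℂ) • f : weightedSpace a hapos).1 x‖) ≤ 1 := by
    refine ciSup_le fun x => ?_
    have : ‖(((C⁻¹ : ℝ) : ℂ) • f : weightedSpace a hapos).1 x‖ = C⁻¹ * ‖(f : X → ℂ) x‖ := by
      simp [abs_of_pos hC]
    rw [this]
    calc a n x * (C⁻¹ * ‖(f : X → ℂ) x‖) = C⁻¹ * (a n x * ‖(f : X → ℂ) x‖) := by ring
      _ ≤ C⁻¹ * C := mul_le_mul_of_nonneg_left (h x) (inv_pos.2 hC).le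
      _ = 1 := inv_mul_cancel₀ hC.ne'
  have h2 := le_iSup₂ (f := fun (f : weightedSpace a hapos)
    (_ : (⨆ x, a n x * ‖(f : X → ℂ) x‖) ≤ 1) => (‖y f‖₊ : ℝ≥0∞)) _ h1
  refine le_trans ?_ (mul_le_mul_right h2 _)
  have h3 : y f = ((C : ℝ) : ℂ) * y (((C⁻¹ : ℝ) : ℂ) • f) := by
    rw [map_smul, smul_eq_mul, ← mul_assoc, ← Complex.ofReal_mul, mul_inv_cancel₀ hC.ne']
    simp
  rw [h3, nnnorm_mul, ENNReal.coe_mul]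
  apply le_of_eq
  congr 1
  rw [← enorm_eq_nnnorm, ← ofReal_norm_eq_enorm]
  simp [abs_of_pos hC]

/-- Multiplication by a continuous function with values in `[0,1]`. -/
theorem ws_mul_mem (f : weightedSpace a hapos) (c : X → ℝ) (hc : Continuous c)
    (h0 : ∀ x, 0 ≤ c x) (h1 : ∀ x, c x ≤ 1) :
    (fun x => (c x : ℂ) * (f : X → ℂ) x) ∈ weightedSpace a hapos := by
  refine ⟨(Complex.continuous_ofReal.comp hc).mul f.2.1, fun n => ?_⟩
  refine squeeze_zero (fun x => mul_nonneg (hapos n x).le (norm_nonneg _)) (fun x => ?_) (f.2.2 n)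
  refine mul_le_mul_of_nonneg_left ?_ (hapos n x).le
  rw [norm_mul, Complex.norm_real, Real.norm_of_nonneg (h0 x)]
  exact mul_le_of_le_one_left (norm_nonneg _) (h1 x)

theorem ws_delta [T2Space X] [LocallyCompactSpace X] [Nonempty X]
    (hacont : ∀ n, Continuous (a n)) (n : ℕ) (x : X) :
    (⨆ (f : weightedSpace a hapos) (_ : (⨆ x, a n x * ‖(f : X → ℂ) x‖) ≤ 1),
        (‖((LinearMap.proj x : (X → ℂ) →ₗ[ℂ] ℂ).comp (weightedSpace a hapos).subtype) f‖₊ : ℝ≥0∞))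
      = ENNReal.ofReal (1 / a n x) := by
  apply le_antisymm
  · refine iSup₂_le fun f hf => ?_
    have := ws_le hacont n f hf x
    rw [← enorm_eq_nnnorm, ← ofReal_norm_eq_enorm]
    apply ENNReal.ofReal_le_ofReal
    rw [le_div_iff₀' (hapos n x)]
    simpa using this
  · obtain ⟨φ, hφ1, -, hφc, hφ⟩ := exists_continuous_one_zero_of_isCompact
      (isCompact_singleton (x := x)) isClosed_empty (disjoint_empty _)
    have hmem : (fun z => ((φ z / a n z : ℝ) : ℂ)) ∈ weightedSpace a hapos := by
      refine ⟨Complex.continuous_ofReal.comp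
        (φ.continuous.div (hacont n) fun z => (hapos n z).ne'), fun m => ?_⟩
      refine tendsto_const_nhds.congr' ?_
      have : ∀ᶠ z in cocompact X, φ z = 0 := by
        filter_upwards [hφc.isCompact.compl_mem_cocompact] with z hz
        exact image_eq_zero_of_notMem_tsupport hz
      filter_upwards [this] with z hz
      simp [hz]
    have h1 : (⨆ z, a n z * ‖(⟨_, hmem⟩ : weightedSpace a hapos).1 z‖) ≤ 1 := by
      refine ciSup_le fun z => ?_
      simp only [Complex.norm_real]
      rw [Real.norm_of_nonneg (div_nonneg (hφ z).1 (hapos n z).le),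
        mul_div_cancel₀ _ (hapos n z).ne']
      exact (hφ z).2
    refine le_trans ?_ (le_iSup₂ (⟨_, hmem⟩ : weightedSpace a hapos) h1)
    rw [← enorm_eq_nnnorm, ← ofReal_norm_eq_enorm]
    apply ENNReal.ofReal_le_ofReal
    have : φ x = 1 := hφ1 rfl
    simp [this, abs_of_pos (hapos n x)]

theorem ws_split [Nonempty X] (hacont : ∀ n, Continuous (a n)) {N M K : ℕ} {D θ s t : ℝ}
    (hD : 0 < D) (hθ : θ ∈ Set.Ioo (0 : ℝ) 1)
    (hs : 0 < s) (ht : 0 < t) (hst : s ^ θ * t ^ (1 - θ) = 1)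
    (H : ∀ x, 1 / a M x ≤ D * (1 / a K x) ^ θ * (1 / a N x) ^ (1 - θ))
    (f : weightedSpace a hapos) (hf : ∀ x, a M x * ‖(f : X → ℂ) x‖ ≤ 1) :
    ∃ f1 f2 : weightedSpace a hapos, f = f1 + f2 ∧
      (∀ x, a K x * ‖(f1 : X → ℂ) x‖ ≤ D * s) ∧ (∀ x, a N x * ‖(f2 : X → ℂ) x‖ ≤ D * t) := by
  have key : ∀ x, ‖(f : X → ℂ) x‖ ≤ D * (s / a K x + t / a N x) := by
    intro x
    have hK := hapos K x
    have hN := hapos N x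
    have h1 : ‖(f : X → ℂ) x‖ ≤ 1 / a M x := by
      rw [le_div_iff₀' (hapos M x)]; exact hf x
    refine h1.trans ((H x).trans ?_)
    rw [mul_assoc]
    refine mul_le_mul_of_nonneg_left ?_ hD.le
    have h2 := Real.geom_mean_le_arith_mean2_weighted hθ.1.le (sub_nonneg.2 hθ.2.le)
      (div_pos hs hK).le (div_pos ht hN).le (by ring)
    have h3 : (s / a K x) ^ θ * (t / a N x) ^ (1 - θ)
        = (1 / a K x) ^ θ * (1 / a N x) ^ (1 - θ) := by
      rw [div_eq_mul_one_div s, div_eq_mul_one_div t, Real.mul_rpow hs.le (by positivity),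
        Real.mul_rpow ht.le (by positivity)]
      linear_combination ((1 / a K x) ^ θ * (1 / a N x) ^ (1 - θ)) * hst
    rw [h3] at h2
    have h4 : 0 < s / a K x := div_pos hs hK
    have h5 : 0 < t / a N x := div_pos ht hN
    nlinarith [hθ.1, hθ.2]
  have hu : ∀ x, 0 < s / a K x := fun x => div_pos hs (hapos K x)
  have hv : ∀ x, 0 < t / a N x := fun x => div_pos ht (hapos N x)
  have hw : ∀ x, 0 < s / a K x + t / a N x := fun x => add_pos (hu x) (hv x)
  have cu : Continuous fun x => s / a K x := continuous_const.div (hacont K) fun x => (hapos K x).ne'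
  have cv : Continuous fun x => t / a N x := continuous_const.div (hacont N) fun x => (hapos N x).ne'
  have m1 := ws_mul_mem f (fun x => (s / a K x) / (s / a K x + t / a N x))
    (cu.div (cu.add cv) fun x => (hw x).ne') (fun x => (div_pos (hu x) (hw x)).le)
    (fun x => (div_le_one (hw x)).2 (by linarith [hv x]))
  have m2 := ws_mul_mem f (fun x => (t / a N x) / (s / a K x + t / a N x))
    (cv.div (cu.add cv) fun x => (hw x).ne') (fun x => (div_pos (hv x) (hw x)).le)
    (fun x => (div_le_one (hw x)).2 (by linarith [hu x]))
  have aux : ∀ (b p w r : ℝ) (z : ℂ), 0 < b → 0 < p → 0 < w → ‖z‖ ≤ D * w → p = r / b →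
      b * ‖((p / w : ℝ) : ℂ) * z‖ ≤ D * r := by
    intro b p w r z hb hp hw hz hpr
    rw [norm_mul, Complex.norm_real, Real.norm_of_nonneg (div_pos hp hw).le]
    calc b * (p / w * ‖z‖) ≤ b * (p / w * (D * w)) := by gcongr
      _ = D * r := by subst hpr; field_simp
  refine ⟨⟨_, m1⟩, ⟨_, m2⟩, ?_, fun x => ?_, fun x => ?_⟩
  · ext x
    simp only [Submodule.coe_add, Pi.add_apply]
    rw [← add_mul, ← Complex.ofReal_add, ← add_div, div_self (hw x).ne']
    simp
  · exact aux _ _ _ _ _ (hapos K x) (hu x) (hw x) (key x) rfl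
  · exact aux _ _ _ _ _ (hapos N x) (hv x) (hw x) (key x) rfl

end helpers

/-- For an increasing sequence of weights `a` on a nonempty Hausdorff
locally compact σ-compact space `X`, the weighted Fréchet space `E` of continuous
functions `f` with `aₙ·|f|` vanishing at infinity satisfies condition (Ω) (formulated
with the extended-real dual norms `‖y‖*ₙ = sup {‖y f‖ : ‖f‖ₙ ≤ 1}` of linear
functionals) if and only if the sequence `a` satisfies the weight condition `(Ω)_w`. -/
theorem stmt_2 {X : Type*} [TopologicalSpace X] [Nonempty X] [T2Space X]
    [LocallyCompactSpace X] [SigmaCompactSpace X]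
    (a : ℕ → X → ℝ)
    (hacont : ∀ n, Continuous (a n)) (hapos : ∀ n x, 0 < a n x)
    (hamono : ∀ n x, a n x ≤ a (n + 1) x)
    (dual : ℕ → ((weightedSpace a hapos) →ₗ[ℂ] ℂ) → ℝ≥0∞)
    (hdual : ∀ n y, dual n y =
      ⨆ (f : weightedSpace a hapos) (_ : (⨆ x, a n x * ‖(f : X → ℂ) x‖) ≤ 1),
        (‖y f‖₊ : ℝ≥0∞)) :
    (∀ N, ∃ M, N ≤ M ∧ ∀ K, M ≤ K → ∃ D > (0 : ℝ), ∃ θ ∈ Set.Ioo (0 : ℝ) 1,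
      ∀ y : (weightedSpace a hapos) →ₗ[ℂ] ℂ,
        dual M y ≤ ENNReal.ofReal D * dual K y ^ θ * dual N y ^ (1 - θ)) ↔
    (∀ N, ∃ M, N ≤ M ∧ ∀ K, M ≤ K → ∃ D > (0 : ℝ), ∃ θ ∈ Set.Ioo (0 : ℝ) 1,
      ∀ x, 1 / a M x ≤ D * (1 / a K x) ^ θ * (1 / a N x) ^ (1 - θ)) := by
  have hbound : ∀ n (y : (weightedSpace a hapos) →ₗ[ℂ] ℂ) (f : weightedSpace a hapos) (C : ℝ),
      0 < C → (∀ x, a n x * ‖(f : X → ℂ) x‖ ≤ C) →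
      (‖y f‖₊ : ℝ≥0∞) ≤ ENNReal.ofReal C * dual n y := by
    intro n y f C hC h
    rw [hdual]
    exact ws_dual_bound n y f hC h
  have hzero : ∀ n y, dual n y = 0 → y = 0 := by
    intro n y h
    ext f
    obtain ⟨C, hC⟩ := ws_bdd hacont n f
    have := hbound n y f (max C 1) (by positivity)
      (fun x => (hC (Set.mem_range_self x)).trans (le_max_left _ _))
    rw [h, mul_zero] at this
    simpa using this
  constructor
  · intro h N
    obtain ⟨M, hNM, h⟩ := h N
    refine ⟨M, hNM, fun K hK => ?_⟩
    obtain ⟨D, hD, θ, hθ, h⟩ := h K hK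
    refine ⟨D, hD, θ, hθ, fun x => ?_⟩
    have h := h ((LinearMap.proj x : (X → ℂ) →ₗ[ℂ] ℂ).comp (weightedSpace a hapos).subtype)
    rw [hdual, hdual, hdual, ws_delta hacont, ws_delta hacont, ws_delta hacont] at h
    have hKx : 0 < 1 / a K x := one_div_pos.2 (hapos K x)
    have hNx : 0 < 1 / a N x := one_div_pos.2 (hapos N x)
    rw [ENNReal.ofReal_rpow_of_pos hKx, ENNReal.ofReal_rpow_of_pos hNx,
      ← ENNReal.ofReal_mul hD.le, ← ENNReal.ofReal_mul (by positivity)] at h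
    exact (ENNReal.ofReal_le_ofReal_iff (by positivity)).1 h
  · intro h N
    obtain ⟨M, hNM, h⟩ := h N
    refine ⟨M, hNM, fun K hK => ?_⟩
    obtain ⟨D, hD, θ, hθ, h⟩ := h K hK
    have hθ0 : 0 < θ := hθ.1
    have hθ1 : 0 < 1 - θ := sub_pos.2 hθ.2
    refine ⟨2 * D, by positivity, θ, hθ, fun y => ?_⟩
    by_cases hy : y = 0
    · rw [hdual M, hy]; simp
    have hP0 : dual K y ≠ 0 := fun h0 => hy (hzero _ _ h0)
    have hQ0 : dual N y ≠ 0 := fun h0 => hy (hzero _ _ h0)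
    have hD0 : ENNReal.ofReal (2 * D) ≠ 0 := by simpa using hD
    by_cases hPt : dual K y = ⊤
    · rw [hPt, ENNReal.top_rpow_of_pos hθ0, ENNReal.mul_top hD0, ENNReal.top_mul]
      · exact le_top
      · simp [ENNReal.rpow_eq_zero_iff, hQ0, hθ1.not_gt]
    by_cases hQt : dual N y = ⊤
    · rw [hQt, ENNReal.top_rpow_of_pos hθ1, ENNReal.mul_top]
      · exact le_top
      · refine mul_ne_zero hD0 ?_
        simp [ENNReal.rpow_eq_zero_iff, hP0, hθ0.not_gt]
    obtain ⟨P, hP⟩ : ∃ P, P = (dual K y).toReal := ⟨_, rfl⟩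
    obtain ⟨Q, hQ⟩ : ∃ Q, Q = (dual N y).toReal := ⟨_, rfl⟩
    have hPp : 0 < P := hP ▸ ENNReal.toReal_pos hP0 hPt
    have hQp : 0 < Q := hQ ▸ ENNReal.toReal_pos hQ0 hQt
    have hPe : dual K y = ENNReal.ofReal P := by rw [hP, ENNReal.ofReal_toReal hPt]
    have hQe : dual N y = ENNReal.ofReal Q := by rw [hQ, ENNReal.ofReal_toReal hQt]
    have hs : 0 < (Q / P) ^ (1 - θ) := by positivity
    have ht : 0 < (Q / P) ^ (-θ) := by positivity
    have hst : ((Q / P) ^ (1 - θ)) ^ θ * ((Q / P) ^ (-θ)) ^ (1 - θ) = 1 := by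
      rw [← Real.rpow_mul (by positivity), ← Real.rpow_mul (by positivity),
        ← Real.rpow_add (by positivity)]
      ring_nf
      simp
    have e1 : (Q / P) ^ (1 - θ) * P = P ^ θ * Q ^ (1 - θ) := by
      rw [Real.div_rpow hQp.le hPp.le, Real.rpow_sub hPp 1 θ, Real.rpow_one]
      field_simp
    have e2 : (Q / P) ^ (-θ) * Q = P ^ θ * Q ^ (1 - θ) := by
      rw [Real.div_rpow hQp.le hPp.le, Real.rpow_sub hQp 1 θ, Real.rpow_one,
        Real.rpow_neg hPp.le, Real.rpow_neg hQp.le]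
      field_simp
    rw [hdual M, hPe, hQe]
    refine iSup₂_le fun f hf => ?_
    obtain ⟨f1, f2, hff, h1, h2⟩ := ws_split hacont hD hθ hs ht hst h f (ws_le hacont M f hf)
    have b1 := hbound K y f1 _ (by positivity) h1
    have b2 := hbound N y f2 _ (by positivity) h2
    rw [hPe, ← ENNReal.ofReal_mul (by positivity)] at b1
    rw [hQe, ← ENNReal.ofReal_mul (by positivity)] at b2
    have b3 : (‖y f‖₊ : ℝ≥0∞) ≤ ‖y f1‖₊ + ‖y f2‖₊ := by
      rw [hff, map_add]
      exact_mod_cast nnnorm_add_le _ _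
    refine b3.trans ((add_le_add b1 b2).trans ?_)
    rw [ENNReal.ofReal_rpow_of_pos hPp, ENNReal.ofReal_rpow_of_pos hQp,
      ← ENNReal.ofReal_mul (by positivity), ← ENNReal.ofReal_mul (by positivity),
      ← ENNReal.ofReal_add (by positivity) (by positivity)]
    apply ENNReal.ofReal_le_ofReal
    apply le_of_eq
    linear_combination D * e1 + D * e2
end

section
/- Let X₁ and X₂ be nonempty Hausdorff, locally compact and σ-compact topological spaces, let A¹ = (a¹_N) be an increasing sequence of weights on X₁ and A² = (a²_n) an increasing sequence of weights on X₂. Let E₁ be the set of continuous f : X₁ → ℂ with a¹_N·|f| vanishing at infinity for all N, with seminorms ‖f‖_N = sup a¹_N·|f|, and E₂ analogously for A². Assume E₁ satisfies condition (Ω) with respect to its canonical seminorms (∀ N, ∃ M ≥ N, ∀ K ≥ M, ∃ D > 0, θ ∈ (0,1), such that every linear functional y : E₁ → ℂ satisfies ‖y‖*_M ≤ D·(‖y‖*_K)^θ·(‖y‖*_N)^{1−θ} in [0,∞], where ‖y‖*_n = sup{|y(f)| : ‖f‖_n ≤ 1}), and that E₂ satisfies condition (DN) with respect to its canonical seminorms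 (∃ n, ∀ m ≥ n, ∀ θ ∈ (0,1), ∃ k ≥ m, ∃ C > 0, ∀ f ∈ E₂: ‖f‖_m ≤ C·‖f‖_k^θ·‖f‖_n^{1−θ}). Then the double sequence 𝒜 on X₁ × X₂ given by a_{N,n}(x₁,x₂) := a¹_N(x₁)/a²_n(x₂) satisfies condition (wQ). -/
open Set Filter Topology ENNReal

theorem bump_aux {X : Type*} [TopologicalSpace X] [T2Space X] [LocallyCompactSpace X]
    (x : X) (U : Set X) (hU : IsOpen U) (hx : x ∈ U) :
    ∃ φ : X → ℝ, Continuous φ ∧ φ x = 1 ∧ (∀ z, z ∉ U → φ z = 0) ∧ HasCompactSupport φ ∧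
      ∀ z, 0 ≤ φ z ∧ φ z ≤ 1 := by
  obtain ⟨f, h1, h2, h3, h4⟩ := exists_continuous_one_zero_of_isCompact
    (isCompact_singleton (x := x)) hU.isClosed_compl
    (Set.disjoint_singleton_left.2 (by simpa using hx))
  exact ⟨f, f.continuous, h1 rfl, fun z hz => h2 hz, h3, fun z => h4 z⟩

theorem mem_aux {X : Type*} [TopologicalSpace X]
    (a : ℕ → X → ℝ) (hapos : ∀ n x, 0 < a n x)
    (f : X → ℝ) (hf : Continuous f) (hc : HasCompactSupport f) :
    (fun z => (f z : ℂ)) ∈ weightedSpace a hapos := by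
  refine ⟨Complex.continuous_ofReal.comp hf, fun n => ?_⟩
  refine tendsto_const_nhds.congr' ?_
  have : (tsupport f)ᶜ ∈ cocompact X := hc.isCompact.compl_mem_cocompact
  filter_upwards [this] with z hz
  simp [image_eq_zero_of_notMem_tsupport hz]

theorem bdd_aux {X : Type*} [TopologicalSpace X]
    (a : ℕ → X → ℝ) (hapos : ∀ n x, 0 < a n x) (hcont : ∀ n, Continuous (a n))
    (f : X → ℂ) (hf : f ∈ weightedSpace a hapos) (n : ℕ) :
    BddAbove (Set.range fun x => a n x * ‖f x‖) := by
  have hc : Continuous fun x => a n x * ‖f x‖ := (hcont n).mul hf.1.norm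
  have h := (hf.2 n).eventually (gt_mem_nhds (zero_lt_one))
  obtain ⟨K, hK, hKs⟩ := mem_cocompact.1 h
  obtain ⟨B, hB⟩ := hK.bddAbove_image hc.continuousOn
  refine ⟨max B 1, ?_⟩
  rintro _ ⟨x, rfl⟩
  by_cases hx : x ∈ K
  · exact le_max_of_le_left (hB ⟨x, hx, rfl⟩)
  · exact le_max_of_le_right (le_of_lt (hKs hx))

theorem dual_le_aux {X : Type*} [TopologicalSpace X]
    (a : ℕ → X → ℝ) (hapos : ∀ n x, 0 < a n x) (hcont : ∀ n, Continuous (a n))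
    (x : X) (n : ℕ) :
    (⨆ (f : weightedSpace a hapos) (_ : (⨆ x, a n x * ‖(f : X → ℂ) x‖) ≤ 1),
      (‖((LinearMap.proj x).comp (weightedSpace a hapos).subtype :
        weightedSpace a hapos →ₗ[ℂ] ℂ) f‖₊ : ℝ≥0∞)) ≤ ENNReal.ofReal (1 / a n x) := by
  refine iSup₂_le fun f hf => ?_
  have h := (le_ciSup (bdd_aux a hapos hcont f f.2 n) x).trans hf
  rw [← ofReal_coe_nnreal]
  refine ENNReal.ofReal_le_ofReal ?_
  rw [le_div_iff₀ (hapos n x), mul_comm]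
  exact h

theorem le_dual_aux {X : Type*} [TopologicalSpace X] [T2Space X] [LocallyCompactSpace X]
    (a : ℕ → X → ℝ) (hapos : ∀ n x, 0 < a n x) (hcont : ∀ n, Continuous (a n))
    (x : X) (n : ℕ) :
    ENNReal.ofReal (1 / a n x) ≤
    (⨆ (f : weightedSpace a hapos) (_ : (⨆ x, a n x * ‖(f : X → ℂ) x‖) ≤ 1),
      (‖((LinearMap.proj x).comp (weightedSpace a hapos).subtype :
        weightedSpace a hapos →ₗ[ℂ] ℂ) f‖₊ : ℝ≥0∞)) := by
  obtain ⟨φ, h1, h2, -, h4, h5⟩ := bump_aux x Set.univ isOpen_univ trivial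
  have hm := mem_aux a hapos (fun z => φ z * (a n z)⁻¹)
    (h1.mul ((hcont n).inv₀ fun z => (hapos n z).ne')) h4.mul_right
  have : Nonempty X := ⟨x⟩
  refine le_iSup₂_of_le ⟨_, hm⟩ ?_ ?_
  · refine ciSup_le fun z => ?_
    have hz := hapos n z
    simp only [Complex.norm_real, Real.norm_eq_abs]
    rw [abs_of_nonneg (mul_nonneg (h5 z).1 (inv_nonneg.2 hz.le))]
    calc a n z * (φ z * (a n z)⁻¹) = φ z := by field_simp
      _ ≤ 1 := (h5 z).2
  · rw [← ofReal_coe_nnreal]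
    refine ENNReal.ofReal_le_ofReal ?_
    simp [h2, abs_of_pos (hapos n x)]

theorem omega_aux {X : Type*} [TopologicalSpace X] [T2Space X] [LocallyCompactSpace X]
    (a : ℕ → X → ℝ) (hapos : ∀ n x, 0 < a n x) (hcont : ∀ n, Continuous (a n))
    (N M K : ℕ) (D θ : ℝ) (hD : 0 < D) (hθ : θ ∈ Set.Ioo (0 : ℝ) 1)
    (h : ∀ y : (weightedSpace a hapos) →ₗ[ℂ] ℂ,
        (⨆ (f : weightedSpace a hapos)
            (_ : (⨆ x, a M x * ‖(f : X → ℂ) x‖) ≤ 1), (‖y f‖₊ : ℝ≥0∞)) ≤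
          ENNReal.ofReal D *
            (⨆ (f : weightedSpace a hapos)
              (_ : (⨆ x, a K x * ‖(f : X → ℂ) x‖) ≤ 1), (‖y f‖₊ : ℝ≥0∞)) ^ θ *
            (⨆ (f : weightedSpace a hapos)
              (_ : (⨆ x, a N x * ‖(f : X → ℂ) x‖) ≤ 1), (‖y f‖₊ : ℝ≥0∞)) ^ (1 - θ))
    (x : X) : 1 / a M x ≤ D * (1 / a K x) ^ θ * (1 / a N x) ^ (1 - θ) := by
  have hθ1 : 0 ≤ 1 - θ := by linarith [hθ.2]
  have pK : 0 < 1 / a K x := one_div_pos.2 (hapos K x)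
  have pN : 0 < 1 / a N x := one_div_pos.2 (hapos N x)
  have key := (le_dual_aux a hapos hcont x M).trans (h _)
  have key2 : ENNReal.ofReal (1 / a M x) ≤ ENNReal.ofReal D *
      ENNReal.ofReal (1 / a K x) ^ θ * ENNReal.ofReal (1 / a N x) ^ (1 - θ) := by
    refine key.trans ?_
    refine mul_le_mul' (mul_le_mul' le_rfl ?_) ?_
    · exact ENNReal.rpow_le_rpow (dual_le_aux a hapos hcont x K) hθ.1.le
    · exact ENNReal.rpow_le_rpow (dual_le_aux a hapos hcont x N) hθ1
  rw [ENNReal.ofReal_rpow_of_pos pK, ENNReal.ofReal_rpow_of_pos pN,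
    ← ENNReal.ofReal_mul hD.le, ← ENNReal.ofReal_mul (by positivity)] at key2
  exact (ENNReal.ofReal_le_ofReal_iff (by positivity)).1 key2

theorem dn_aux {X : Type*} [TopologicalSpace X] [T2Space X] [LocallyCompactSpace X]
    (a : ℕ → X → ℝ) (hapos : ∀ n x, 0 < a n x) (hcont : ∀ n, Continuous (a n))
    (n m k : ℕ) (C θ : ℝ) (hC : 0 < C) (hθ : θ ∈ Set.Ioo (0 : ℝ) 1)
    (h : ∀ f ∈ weightedSpace a hapos,
        (⨆ x, a m x * ‖f x‖) ≤
          C * (⨆ x, a k x * ‖f x‖) ^ θ * (⨆ x, a n x * ‖f x‖) ^ (1 - θ))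
    (x : X) : a m x ≤ C * (2 * a k x) ^ θ * (2 * a n x) ^ (1 - θ) := by
  have hθ1 : 0 ≤ 1 - θ := by linarith [hθ.2]
  have pk := hapos k x
  have pn := hapos n x
  obtain ⟨φ, h1, h2, h3, h4, h5⟩ := bump_aux x
    ({z | a k z < 2 * a k x} ∩ {z | a n z < 2 * a n x})
    ((isOpen_lt (hcont k) continuous_const).inter (isOpen_lt (hcont n) continuous_const))
    ⟨by simp only [Set.mem_ofPred_eq]; linarith, by simp only [Set.mem_ofPred_eq]; linarith⟩
  have hm := mem_aux a hapos φ h1 h4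
  have : Nonempty X := ⟨x⟩
  have hle := le_ciSup (bdd_aux a hapos hcont _ hm m) x
  have hh := h _ hm
  have nn : ∀ j, 0 ≤ ⨆ z, a j z * ‖(φ z : ℂ)‖ := fun j =>
    Real.iSup_nonneg fun z => mul_nonneg (hapos j z).le (norm_nonneg _)
  have bd : ∀ j, (∀ z, z ∈ ({z | a k z < 2 * a k x} ∩ {z | a n z < 2 * a n x}) →
      a j z ≤ 2 * a j x) → (⨆ z, a j z * ‖(φ z : ℂ)‖) ≤ 2 * a j x := by
    intro j hj
    refine ciSup_le fun z => ?_
    rw [Complex.norm_real, Real.norm_eq_abs, abs_of_nonneg (h5 z).1]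
    by_cases hz : z ∈ ({z | a k z < 2 * a k x} ∩ {z | a n z < 2 * a n x})
    · exact (mul_le_of_le_one_right (hapos j z).le (h5 z).2).trans (hj z hz)
    · rw [h3 z hz, mul_zero]; linarith [hapos j x]
  have bk := bd k fun z hz => le_of_lt hz.1
  have bn := bd n fun z hz => le_of_lt hz.2
  have hx : a m x ≤ ⨆ z, a m z * ‖(φ z : ℂ)‖ := by
    simpa [h2] using hle
  refine hx.trans (hh.trans ?_)
  refine mul_le_mul (mul_le_mul_of_nonneg_left (Real.rpow_le_rpow (nn k) bk hθ.1.le) hC.le)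
    (Real.rpow_le_rpow (nn n) bn hθ1) (Real.rpow_nonneg (nn n) _) (by positivity)

/-- Let `a₁`, `a₂` be increasing sequences of weights on nonempty
Hausdorff locally compact σ-compact spaces `X₁`, `X₂`. If the weighted Fréchet space
`E₁` (on `X₁`) satisfies condition (Ω) with respect to its canonical seminorms and the
weighted Fréchet space `E₂` (on `X₂`) satisfies condition (DN), then the double
sequence `a_{N,n}(x₁,x₂) = a₁ N x₁ / a₂ n x₂` on `X₁ × X₂` satisfies `(wQ)`. -/
theorem stmt_3 {X₁ X₂ : Type*} [TopologicalSpace X₁] [Nonempty X₁] [T2Space X₁]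
    [LocallyCompactSpace X₁] [SigmaCompactSpace X₁]
    [TopologicalSpace X₂] [Nonempty X₂] [T2Space X₂]
    [LocallyCompactSpace X₂] [SigmaCompactSpace X₂]
    (a₁ : ℕ → X₁ → ℝ) (a₂ : ℕ → X₂ → ℝ)
    (ha₁cont : ∀ N, Continuous (a₁ N)) (ha₁pos : ∀ N x, 0 < a₁ N x)
    (ha₁mono : ∀ N x, a₁ N x ≤ a₁ (N + 1) x)
    (ha₂cont : ∀ n, Continuous (a₂ n)) (ha₂pos : ∀ n x, 0 < a₂ n x)
    (ha₂mono : ∀ n x, a₂ n x ≤ a₂ (n + 1) x)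
    (hΩ : ∀ N, ∃ M, N ≤ M ∧ ∀ K, M ≤ K → ∃ D > (0 : ℝ), ∃ θ ∈ Set.Ioo (0 : ℝ) 1,
      ∀ y : (weightedSpace a₁ ha₁pos) →ₗ[ℂ] ℂ,
        (⨆ (f : weightedSpace a₁ ha₁pos)
            (_ : (⨆ x, a₁ M x * ‖(f : X₁ → ℂ) x‖) ≤ 1), (‖y f‖₊ : ℝ≥0∞)) ≤
          ENNReal.ofReal D *
            (⨆ (f : weightedSpace a₁ ha₁pos)
              (_ : (⨆ x, a₁ K x * ‖(f : X₁ → ℂ) x‖) ≤ 1), (‖y f‖₊ : ℝ≥0∞)) ^ θ *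
            (⨆ (f : weightedSpace a₁ ha₁pos)
              (_ : (⨆ x, a₁ N x * ‖(f : X₁ → ℂ) x‖) ≤ 1), (‖y f‖₊ : ℝ≥0∞)) ^ (1 - θ))
    (hDN : ∃ n, ∀ m, n ≤ m → ∀ θ ∈ Set.Ioo (0 : ℝ) 1, ∃ k, m ≤ k ∧ ∃ C > (0 : ℝ),
      ∀ f ∈ weightedSpace a₂ ha₂pos,
        (⨆ x, a₂ m x * ‖f x‖) ≤
          C * (⨆ x, a₂ k x * ‖f x‖) ^ θ * (⨆ x, a₂ n x * ‖f x‖) ^ (1 - θ)) :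
    ∀ N, ∃ M, N ≤ M ∧ ∃ n, ∀ K, M ≤ K → ∀ m, ∃ k, ∃ S > (0 : ℝ),
      ∀ (x₁ : X₁) (x₂ : X₂),
        1 / (a₁ M x₁ / a₂ m x₂) ≤
          max (S / (a₁ N x₁ / a₂ n x₂)) (S / (a₁ K x₁ / a₂ k x₂)) := by
  intro N
  obtain ⟨M, hNM, hM⟩ := hΩ N
  obtain ⟨n, hn⟩ := hDN
  refine ⟨M, hNM, n, fun K hK m => ?_⟩
  obtain ⟨D, hD, θ, hθ, hy⟩ := hM K hK
  obtain ⟨k, -, C, hC, hf⟩ := hn (max m n) (le_max_right _ _) θ hθ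
  have hθ1 : 0 ≤ 1 - θ := by linarith [hθ.2]
  refine ⟨k, D * C * 2, by positivity, fun x₁ x₂ => ?_⟩
  have e1 := omega_aux a₁ ha₁pos ha₁cont N M K D θ hD hθ hy x₁
  have e2 := dn_aux a₂ ha₂pos ha₂cont n (max m n) k C θ hC hθ hf x₂
  have e3 : a₂ m x₂ ≤ a₂ (max m n) x₂ :=
    monotone_nat_of_le_succ (f := fun j => a₂ j x₂) (fun j => ha₂mono j x₂) (le_max_left m n)
  have pM := ha₁pos M x₁
  have pK := ha₁pos K x₁
  have pN := ha₁pos N x₁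
  have pm := ha₂pos m x₂
  have pk := ha₂pos k x₂
  have pn := ha₂pos n x₂
  set u := a₂ n x₂ / a₁ N x₁ with hu
  set v := a₂ k x₂ / a₁ K x₁ with hv
  have pu : 0 < u := by positivity
  have pv : 0 < v := by positivity
  have t1 : D * C * 2 / (a₁ N x₁ / a₂ n x₂) = D * C * 2 * u := by rw [hu]; field_simp
  have t2 : D * C * 2 / (a₁ K x₁ / a₂ k x₂) = D * C * 2 * v := by rw [hv]; field_simp
  rw [t1, t2, ← mul_max_of_nonneg _ _ (by positivity : 0 ≤ D * C * 2)]
  have pw : 0 < max u v := lt_max_of_lt_left pu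
  calc 1 / (a₁ M x₁ / a₂ m x₂) = 1 / a₁ M x₁ * a₂ m x₂ := by field_simp
    _ ≤ (D * (1 / a₁ K x₁) ^ θ * (1 / a₁ N x₁) ^ (1 - θ)) *
        (C * (2 * a₂ k x₂) ^ θ * (2 * a₂ n x₂) ^ (1 - θ)) :=
        mul_le_mul e1 (e3.trans e2) pm.le (by positivity)
    _ = D * C * (((1 / a₁ K x₁) ^ θ * (2 * a₂ k x₂) ^ θ) *
        ((1 / a₁ N x₁) ^ (1 - θ) * (2 * a₂ n x₂) ^ (1 - θ))) := by ring
    _ = D * C * ((2 * v) ^ θ * (2 * u) ^ (1 - θ)) := by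
        rw [← Real.mul_rpow (by positivity) (by positivity),
          ← Real.mul_rpow (by positivity) (by positivity), hu, hv]
        congr 3 <;> ring
    _ ≤ D * C * ((2 * max u v) ^ θ * (2 * max u v) ^ (1 - θ)) := by
        have := hθ.1.le
        gcongr
        · exact le_max_right _ _
        · exact le_max_left _ _
    _ = D * C * 2 * max u v := by
        rw [← Real.rpow_add (by positivity)]
        simp; ring
end

section
/- Let X be a Hausdorff, locally compact and σ-compact topological space, let A = (a_n)_{n∈ℕ} be an increasing sequence of weights on X, and let E be the set of continuous functions f : X → ℂ such that a_n·|f| vanishes at infinity on X for every n, with ‖f‖_N := sup_{x∈X} a_N(x)·|f(x)|. Then for every N ∈ ℕ and every x₀ ∈ X, the dual norm of the point evaluation δ_{x₀} equals 1/a_N(x₀); that is, sup{ |f(x₀)| : f ∈ E, ‖f‖_N ≤ 1 } = 1/a_N(x₀), and this supremum is attained by some f₀ ∈ E. -/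
open Set Filter Topology

/-- For an increasing sequence of weights `a` on a Hausdorff locally
compact σ-compact space `X`, every `N` and every `x₀ ∈ X`, the dual norm of the point
evaluation `δ_{x₀}` on the weighted space `E` equals `1 / a N x₀`: the supremum of
`‖f x₀‖` over `f ∈ E` with `‖f‖_N ≤ 1` is `1 / a N x₀`, and it is attained. -/
theorem stmt_4 {X : Type*} [TopologicalSpace X] [T2Space X]
    [LocallyCompactSpace X] [SigmaCompactSpace X]
    (a : ℕ → X → ℝ)
    (hacont : ∀ n, Continuous (a n)) (hapos : ∀ n x, 0 < a n x)
    (hamono : ∀ n x, a n x ≤ a (n + 1) x)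
    (N : ℕ) (x₀ : X) :
    IsGreatest {r : ℝ | ∃ f : X → ℂ,
      (Continuous f ∧ ∀ n, Tendsto (fun x => a n x * ‖f x‖) (cocompact X) (𝓝 0)) ∧
      (⨆ x, a N x * ‖f x‖) ≤ 1 ∧ r = ‖f x₀‖} (1 / a N x₀) := by
  constructor
  · obtain ⟨g, hg1, -, hgc, hg⟩ := exists_continuous_one_zero_of_isCompact
      (isCompact_singleton (x := x₀)) isClosed_empty (disjoint_empty _)
    have hn : ∀ x, ‖((g x / a N x : ℝ) : ℂ)‖ = g x / a N x := fun x => by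
      rw [Complex.norm_real, Real.norm_of_nonneg (div_nonneg (hg x).1 (hapos N x).le)]
    refine ⟨fun x => ((g x / a N x : ℝ) : ℂ), ⟨?_, ?_⟩, ?_, ?_⟩
    · exact Complex.continuous_ofReal.comp
        (g.continuous.div (hacont N) fun x => (hapos N x).ne')
    · intro n
      refine tendsto_const_nhds.congr' ?_
      filter_upwards [hgc.isCompact.compl_mem_cocompact] with x hx
      have : g x = 0 := image_eq_zero_of_notMem_tsupport hx
      simp [this]
    · haveI : Nonempty X := ⟨x₀⟩
      refine ciSup_le fun x => ?_
      rw [hn, mul_div_cancel₀ _ (hapos N x).ne']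
      exact (hg x).2
    · have : g x₀ = 1 := hg1 (mem_singleton x₀)
      rw [hn, this]
  · rintro r ⟨f, ⟨hf, hf0⟩, hs, rfl⟩
    have hc : Continuous fun x => a N x * ‖f x‖ := (hacont N).mul hf.norm
    have hb : BddAbove (range fun x => a N x * ‖f x‖) := by
      have := (hf0 N).eventually (gt_mem_nhds one_pos)
      obtain ⟨K, hK, hKs⟩ := mem_cocompact.1 this
      obtain ⟨M, hM⟩ := hK.bddAbove_image hc.continuousOn
      refine ⟨max M 1, ?_⟩
      rintro _ ⟨x, rfl⟩
      by_cases hx : x ∈ K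
      · exact le_max_of_le_left (hM (mem_image_of_mem _ hx))
      · exact le_max_of_le_right (le_of_lt (hKs hx))
    rw [le_div_iff₀ (hapos N x₀), mul_comm]
    exact (le_ciSup hb x₀).trans hs
end

section
/- Consider the double sequence 𝒜 = (a_{N,n})_{N,n∈ℕ} on the set of pairs of positive integers defined by a_{N,n}(i,j) := i^N/j^n for positive integers i, j. Then 𝒜 satisfies condition (wQ): ∀ N, ∃ M ≥ N, ∃ n, ∀ K ≥ M, ∀ m, ∃ k, ∃ S > 0, ∀ positive integers i, j: j^m/i^M ≤ S·max( j^n/i^N, j^k/i^K ). -/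
/-- The double sequence `a_{N,n}(i,j) = i^N / j^n` on pairs of
positive integers satisfies condition `(wQ)`. -/
theorem stmt_8 :
    ∀ N : ℕ+, ∃ M : ℕ+, N ≤ M ∧ ∃ n : ℕ+, ∀ K : ℕ+, M ≤ K → ∀ m : ℕ+,
      ∃ k : ℕ+, ∃ S : ℝ, 0 < S ∧ ∀ i j : ℕ+,
        (j : ℝ) ^ (m : ℕ) / (i : ℝ) ^ (M : ℕ) ≤
          S * max ((j : ℝ) ^ (n : ℕ) / (i : ℝ) ^ (N : ℕ))
              ((j : ℝ) ^ (k : ℕ) / (i : ℝ) ^ (K : ℕ)) := by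
  intro N
  refine ⟨N + 1, (PNat.lt_add_right N 1).le, 1, fun K _ m => ⟨m + m * K, 1, one_pos, fun i j => ?_⟩⟩
  have hi : (1 : ℝ) ≤ (i : ℝ) := by exact_mod_cast i.one_le
  have hj : (1 : ℝ) ≤ (j : ℝ) := by exact_mod_cast j.one_le
  have hi0 : (0 : ℝ) < (i : ℝ) := by linarith
  have hj0 : (0 : ℝ) < (j : ℝ) := by linarith
  rw [one_mul]
  push_cast
  generalize (i : ℝ) = x at *
  generalize (j : ℝ) = y at *
  rcases le_total (y ^ (m : ℕ)) x with h | h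
  · apply le_max_of_le_left
    rw [div_le_div_iff₀ (by positivity) (by positivity), pow_one, pow_succ]
    have hN : 0 < x ^ (N : ℕ) := by positivity
    calc y ^ (m : ℕ) * x ^ (N : ℕ) ≤ x * x ^ (N : ℕ) := by gcongr
      _ = 1 * (x ^ (N : ℕ) * x) := by ring
      _ ≤ y * (x ^ (N : ℕ) * x) := by gcongr
  · apply le_max_of_le_right
    rw [div_le_div_iff₀ (by positivity) (by positivity), pow_add, pow_mul]
    have h1 : x ^ (K : ℕ) ≤ (y ^ (m : ℕ)) ^ (K : ℕ) := by gcongr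
    have h2 : 1 ≤ x ^ ((N : ℕ) + 1) := one_le_pow₀ hi
    calc y ^ (m : ℕ) * x ^ (K : ℕ) ≤ y ^ (m : ℕ) * (y ^ (m : ℕ)) ^ (K : ℕ) := by gcongr
      _ ≤ _ := le_mul_of_one_le_right (by positivity) h2
end

section
/- Consider the double sequence 𝒜 = (a_{N,n})_{N,n∈ℕ} on the set of pairs of positive integers defined by a_{N,n}(i,j) := i^N/j^n for positive integers i, j. Then 𝒜 does NOT satisfy condition (B); that is, it is not the case that for every sequence (n(N))_{N∈ℕ} of positive integers there exists m such that for every M there exist L and c > 0 with i^M/j^m ≤ c·max_{N=1,…,L} i^N/j^{n(N)} for all positive integers i, j. -/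
/-- The double sequence `a_{N,n}(i,j) = i^N / j^n` on pairs of
positive integers does not satisfy condition `(B)`. -/
theorem stmt_9 :
    ¬ ∀ nf : ℕ+ → ℕ+, ∃ m : ℕ+, ∀ M : ℕ+, ∃ L : ℕ+, ∃ c : ℝ, 0 < c ∧
        ∀ i j : ℕ+,
          (i : ℝ) ^ (M : ℕ) / (j : ℝ) ^ (m : ℕ) ≤
            c * (Finset.Icc 1 L).sup' (Finset.nonempty_Icc.mpr L.one_le)
              (fun N => (i : ℝ) ^ (N : ℕ) / (j : ℝ) ^ ((nf N : ℕ+) : ℕ)) := by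
  intro h
  obtain ⟨m, hm⟩ := h id
  obtain ⟨L, c, hc, H⟩ := hm (m + 1)
  obtain ⟨k, hk⟩ := exists_nat_gt c
  have H1 := H k.succPNat k.succPNat
  have ht : (0 : ℝ) < ((k.succPNat : ℕ+) : ℝ) := by
    simp only [Nat.succPNat_coe]; positivity
  have hs : (Finset.Icc 1 L).sup' (Finset.nonempty_Icc.mpr L.one_le)
      (fun N : ℕ+ => ((k.succPNat : ℕ+) : ℝ) ^ (N : ℕ) /
        ((k.succPNat : ℕ+) : ℝ) ^ ((id N : ℕ+) : ℕ)) ≤ 1 := by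
    apply Finset.sup'_le
    intro N _
    exact (div_self (pow_ne_zero _ ht.ne')).le
  have h2 := H1.trans (mul_le_mul_of_nonneg_left hs hc.le)
  rw [PNat.add_coe, PNat.one_coe, pow_succ, mul_div_assoc, mul_comm, div_mul_cancel₀ _ (pow_ne_zero _ ht.ne')] at h2
  simp only [Nat.succPNat_coe] at h2
  push_cast at h2
  linarith
end
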